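/- arXiv:1710.06332 — 2 statements merged into one kernel-verified Lean document; each statement's English description precedes it below -/
import Mathlib

section
/- Let n ≥ 1, let σ > 0, and let A ∈ ℝ^{n×n} be symmetric and invertible. Then for every Schwartz function f on ℝⁿ, ∫_{ℝⁿ} f(x) e^{iσ⟨x,Ax⟩} dx = (π/σ)^{n/2} |det A|^{−1/2} e^{iπ sgn(A)/4} f(0) + (2σ)^{−n/2} |det A|^{−1/2} e^{iπ sgn(A)/4} ∫_{ℝⁿ} ( e^{−i⟨ξ,A^{−1}ξ⟩/(4σ)} − 1 ) (𝓕f)(ξ) dξ. -/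
open MeasureTheory

/-- The quadratic form `x ↦ ⟨x, Ax⟩` on `ℝⁿ`. -/
noncomputable def quadForm {n : ℕ} (A : Matrix (Fin n) (Fin n) ℝ)
    (x : EuclideanSpace ℝ (Fin n)) : ℝ :=
  ∑ i, x i * ∑ j, A i j * x j

open scoped Classical in
/-- The signature of a real symmetric matrix: the number of positive eigenvalues minus the
number of negative eigenvalues (counted with multiplicity). -/
noncomputable def matSgn {n : ℕ} (A : Matrix (Fin n) (Fin n) ℝ) : ℤ :=
  if hA : A.IsHermitian then
    ((Finset.univ.filter fun i => 0 < hA.eigenvalues i).card : ℤ)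
      - ((Finset.univ.filter fun i => hA.eigenvalues i < 0).card : ℤ)
  else 0

/-- The Fourier transform with the normalization `𝓕f(ξ) = (2π)^{−n/2} ∫ f(x) e^{−i⟨x,ξ⟩} dx`. -/
noncomputable def FT {n : ℕ} (f : EuclideanSpace ℝ (Fin n) → ℂ)
    (ξ : EuclideanSpace ℝ (Fin n)) : ℂ :=
  ((2 * Real.pi) ^ (-(n : ℝ) / 2) : ℝ) * ∫ x, f x * Complex.exp (-(Complex.I * ∑ i, x i * ξ i))

open Complex Filter Topology FourierTransform in
lemma fourier_gauss_diag {n : ℕ} (d : Fin n → ℂ) (hd : ∀ i, 0 < (d i).re)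
    (x : EuclideanSpace ℝ (Fin n)) :
    𝓕 (fun w : EuclideanSpace ℝ (Fin n) => cexp (-∑ i, d i * (w i : ℂ) ^ 2)) x
      = (∏ i, (Real.pi / d i) ^ (1 / 2 : ℂ)) * cexp (-∑ i, Real.pi ^ 2 * (x i : ℂ) ^ 2 / d i) := by
  rw [Real.fourier_eq', ← (PiLp.volume_preserving_toLp (Fin n)).integral_comp
    (MeasurableEquiv.toLp 2 _).measurableEmbedding]
  have := GaussianFourier.integral_cexp_neg_sum_mul_add hd (fun i => -2 * Real.pi * I * x i)
  rw [Finset.prod_mul_distrib, ← Complex.exp_sum] at this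
  refine Eq.trans (integral_congr_ae (Filter.Eventually.of_forall fun v => ?_)) (this.trans ?_)
  · change _ • _ = _
    rw [smul_eq_mul, ← Complex.exp_add, add_comm]
    congr 2
    simp only [PiLp.inner_apply, RCLike.inner_apply, conj_trivial]
    push_cast
    rw [Finset.mul_sum, Finset.sum_mul]
    refine Finset.sum_congr rfl fun i _ => ?_
    ring
  · congr 2
    rw [← Finset.sum_neg_distrib]
    refine Finset.sum_congr rfl fun i _ => ?_
    have h0 : d i ≠ 0 := by
      intro h
      have := hd i
      simp [h] at this
    rw [mul_pow, mul_pow, mul_pow, I_sq]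
    field_simp
    ring

open Complex Filter Topology FourierTransform in
lemma integrable_gauss_diag {n : ℕ} (d : Fin n → ℂ) (hd : ∀ i, 0 < (d i).re) :
    Integrable (fun w : EuclideanSpace ℝ (Fin n) => cexp (-∑ i, d i * (w i : ℂ) ^ 2)) := by
  rw [← (PiLp.volume_preserving_toLp (Fin n)).integrable_comp_emb
    (MeasurableEquiv.toLp 2 _).measurableEmbedding]
  have := GaussianFourier.integrable_cexp_neg_sum_mul_add hd (fun _ => 0)
  simpa [Function.comp_def] using this

open Complex Filter Topology FourierTransform in
lemma diag_formula {n : ℕ} (κ : Fin n → ℝ) (hκ : ∀ i, κ i ≠ 0)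
    (f : EuclideanSpace ℝ (Fin n) → ℂ) (hf : Integrable f) (hf' : Integrable (𝓕 f)) :
    ∫ w, 𝓕 f w * cexp (-∑ i, (I * κ i) * (w i : ℂ) ^ 2)
      = (∏ i, (Real.pi / (I * κ i)) ^ (1 / 2 : ℂ)) *
        ∫ x, f x * cexp (-∑ i, Real.pi ^ 2 * (x i : ℂ) ^ 2 / (I * κ i)) := by
  have h0 : ∀ i, (I * κ i) ≠ 0 := fun i => by simp [hκ i]
  have hcont : ∀ i, Tendsto (fun ε : ℝ => (ε : ℂ) + I * κ i) (𝓝[>] 0) (𝓝 (I * κ i)) := by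
    intro i
    have : Continuous (fun ε : ℝ => (ε : ℂ) + I * κ i) := by fun_prop
    have h := this.tendsto 0
    simp only [ofReal_zero, zero_add] at h
    exact h.mono_left nhdsWithin_le_nhds
  have key : ∀ ε : ℝ, 0 < ε → ∫ w, 𝓕 f w * cexp (-∑ i, (ε + I * κ i) * (w i : ℂ) ^ 2)
      = (∏ i, (Real.pi / (ε + I * κ i)) ^ (1 / 2 : ℂ)) *
        ∫ x, f x * cexp (-∑ i, Real.pi ^ 2 * (x i : ℂ) ^ 2 / (ε + I * κ i)) := by
    intro ε hε
    have hd : ∀ i, 0 < ((ε : ℂ) + I * κ i).re := fun i => by simpa using hε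
    have := VectorFourier.integral_fourierIntegral_smul_eq_flip
      (L := innerₗ (EuclideanSpace ℝ (Fin n))) (μ := volume) (ν := volume)
      Real.continuous_fourierChar continuous_inner hf (integrable_gauss_diag _ hd)
    rw [flip_innerₗ] at this
    change ∫ w, 𝓕 f w • _ = ∫ x, f x • 𝓕 (fun w : EuclideanSpace ℝ (Fin n) =>
      cexp (-∑ i, ((ε : ℂ) + I * κ i) * (w i : ℂ) ^ 2)) x at this
    simp only [smul_eq_mul, fourier_gauss_diag _ hd] at this
    rw [this, ← integral_const_mul]
    congr 1; ext x; ring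
  have hre : ∀ ε : ℝ, 0 < ε → ∀ i, 0 ≤ (1 / ((ε : ℂ) + I * κ i)).re := by
    intro ε hε i
    rw [one_div, Complex.inv_re]
    apply div_nonneg _ (normSq_nonneg _)
    simpa using hε.le
  have L1 : Tendsto (fun ε : ℝ => ∫ w, 𝓕 f w * cexp (-∑ i, (ε + I * κ i) * (w i : ℂ) ^ 2))
      (𝓝[>] 0) (𝓝 (∫ w, 𝓕 f w * cexp (-∑ i, (I * κ i) * (w i : ℂ) ^ 2))) := by
    apply tendsto_integral_filter_of_dominated_convergence (fun w => ‖𝓕 f w‖) _ _ hf'.norm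
    · filter_upwards with w
      refine Tendsto.const_mul _ (Tendsto.cexp (Tendsto.neg ?_))
      exact tendsto_finsetSum _ fun i _ => (hcont i).mul_const _
    · filter_upwards with ε
      exact hf'.1.mul (Continuous.aestronglyMeasurable (by fun_prop))
    · filter_upwards [self_mem_nhdsWithin] with ε (hε : 0 < ε)
      filter_upwards with w
      rw [norm_mul, Complex.norm_exp]
      refine mul_le_of_le_one_right (norm_nonneg _) (Real.exp_le_one_iff.2 ?_)
      rw [neg_re, re_sum, neg_nonpos]
      refine Finset.sum_nonneg fun i _ => ?_
      rw [← ofReal_pow, re_mul_ofReal]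
      have : 0 ≤ ((ε : ℂ) + I * κ i).re := by simpa using hε.le
      positivity
  have L2 : Tendsto (fun ε : ℝ => ∫ x, f x * cexp (-∑ i, Real.pi ^ 2 * (x i : ℂ) ^ 2 / (ε + I * κ i)))
      (𝓝[>] 0) (𝓝 (∫ x, f x * cexp (-∑ i, Real.pi ^ 2 * (x i : ℂ) ^ 2 / (I * κ i)))) := by
    apply tendsto_integral_filter_of_dominated_convergence (fun w => ‖f w‖) _ _ hf.norm
    · filter_upwards with w
      refine Tendsto.const_mul _ (Tendsto.cexp (Tendsto.neg ?_))
      exact tendsto_finsetSum _ fun i _ => tendsto_const_nhds.div (hcont i) (h0 i)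
    · filter_upwards with ε
      exact hf.1.mul (Continuous.aestronglyMeasurable (by fun_prop))
    · filter_upwards [self_mem_nhdsWithin] with ε (hε : 0 < ε)
      filter_upwards with w
      rw [norm_mul, Complex.norm_exp]
      refine mul_le_of_le_one_right (norm_nonneg _) (Real.exp_le_one_iff.2 ?_)
      rw [neg_re, re_sum, neg_nonpos]
      refine Finset.sum_nonneg fun i _ => ?_
      rw [← mul_one_div, ← ofReal_pow, ← ofReal_pow, ← ofReal_mul, re_ofReal_mul]
      have := hre ε hε i
      positivity
  have L3 : Tendsto (fun ε : ℝ => ∏ i, (Real.pi / (ε + I * κ i)) ^ (1 / 2 : ℂ))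
      (𝓝[>] 0) (𝓝 (∏ i, (Real.pi / (I * κ i)) ^ (1 / 2 : ℂ))) := by
    refine tendsto_finsetProd _ fun i _ => ?_
    refine Tendsto.cpow (tendsto_const_nhds.div (hcont i) (h0 i)) tendsto_const_nhds ?_
    right
    have : (Real.pi / (I * κ i) : ℂ) = ((-(Real.pi / κ i) : ℝ) : ℂ) * I := by
      have : (κ i : ℂ) ≠ 0 := by simp [hκ i]
      push_cast
      field_simp
      simp
    rw [this]
    simp [Real.pi_ne_zero, hκ i]
  refine tendsto_nhds_unique L1 ((L3.mul L2).congr' ?_)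
  filter_upwards [self_mem_nhdsWithin] with ε (hε : 0 < ε)
  exact (key ε hε).symm

open Complex in
lemma sqrt_factor (μ : ℝ) (hμ : μ ≠ 0) :
    (Real.pi / (I * ((Real.pi ^ 2 / μ : ℝ) : ℂ))) ^ (1 / 2 : ℂ)
      * ((((Real.pi / |μ|) ^ (1 / 2 : ℝ) : ℝ) : ℂ)
        * cexp (I * Real.pi * ((if 0 < μ then 1 else 0) - (if μ < 0 then 1 else 0)) / 4)) = 1 := by
  have hpi := Real.pi_pos
  have hp : 0 < |μ| / Real.pi := by positivity
  have e1 : ∀ r : ℝ, 0 < r → ((r ^ (1 / 2 : ℝ) : ℝ) : ℂ) = cexp ((Real.log r : ℂ) * (1 / 2)) := by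
    intro r hr
    rw [Real.rpow_def_of_pos hr]; push_cast; rfl
  have hlog : Real.log (Real.pi / |μ|) = - Real.log (|μ| / Real.pi) := by
    rw [← Real.log_inv, inv_div]
  have h2 : (Real.pi / (I * ((Real.pi ^ 2 / μ : ℝ) : ℂ))) = ((|μ| / Real.pi : ℝ) : ℂ) *
      ((if 0 < μ then (-I) else I)) := by
    have : (Real.pi : ℂ) ≠ 0 := by simp [Real.pi_ne_zero]
    have : (μ : ℂ) ≠ 0 := by simp [hμ]
    split_ifs with h
    · rw [abs_of_pos h]; push_cast; field_simp; simp
    · rw [abs_of_neg (lt_of_le_of_ne (not_lt.1 h) hμ)]; push_cast; field_simp; simp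
  rw [h2, e1 _ (by positivity), hlog]
  have hne : ((|μ| / Real.pi : ℝ) : ℂ) * ((if 0 < μ then (-I) else I)) ≠ 0 := by
    apply mul_ne_zero
    · exact_mod_cast hp.ne'
    · split_ifs <;> simp
  rw [cpow_def_of_ne_zero hne, Complex.log_ofReal_mul hp (by split_ifs <;> simp), ← Complex.exp_add,
    ← Complex.exp_add, ← Complex.exp_zero]
  congr 1
  rcases lt_or_gt_of_ne hμ with h | h
  · simp only [h, h.not_gt, if_true, if_false, log_I]; push_cast; ring
  · simp only [h, h.not_gt, if_true, if_false, log_neg_I]; push_cast; ring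

lemma quadForm_eigen {n : ℕ} (M : Matrix (Fin n) (Fin n) ℝ) (c : Fin n → ℝ)
    (b : OrthonormalBasis (Fin n) ℝ (EuclideanSpace ℝ (Fin n)))
    (h : ∀ j, M.mulVec (b j) = c j • (b j).ofLp) (y : EuclideanSpace ℝ (Fin n)) :
    quadForm M (b.repr.symm y) = ∑ i, c i * y i ^ 2 := by
  have h1 : ∀ x : EuclideanSpace ℝ (Fin n),
      quadForm M x = inner ℝ x (Matrix.toEuclideanLin M x) := by
    intro x
    simp only [quadForm, PiLp.inner_apply, RCLike.inner_apply, conj_trivial]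
    refine Finset.sum_congr rfl fun i _ => ?_
    rw [mul_comm]; rfl
  have h2 : ∀ j, Matrix.toEuclideanLin M (b j) = c j • b j := by
    intro j
    ext i
    exact congrFun (h j) i
  rw [h1, ← b.repr.inner_map_map]
  have h3 : Matrix.toEuclideanLin M (b.repr.symm y) = b.repr.symm (WithLp.toLp 2 fun i => c i * y i) := by
    rw [← b.sum_repr_symm, ← b.sum_repr_symm, map_sum]
    refine Finset.sum_congr rfl fun i _ => ?_
    rw [map_smul, h2, smul_smul, mul_comm]
  rw [h3]
  simp only [LinearIsometryEquiv.apply_symm_apply, PiLp.inner_apply, RCLike.inner_apply, conj_trivial]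
  refine Finset.sum_congr rfl fun i _ => ?_
  ring

open Complex FourierTransform in
lemma FT_eq {n : ℕ} (f : EuclideanSpace ℝ (Fin n) → ℂ) (ξ : EuclideanSpace ℝ (Fin n)) :
    FT f ξ = ((2 * Real.pi) ^ (-(n : ℝ) / 2) : ℝ) * 𝓕 f ((2 * Real.pi)⁻¹ • ξ) := by
  rw [FT, Real.fourier_eq']
  congr 2
  ext x
  rw [smul_eq_mul, mul_comm]
  congr 2
  simp only [PiLp.inner_apply, RCLike.inner_apply, conj_trivial, PiLp.smul_apply, smul_eq_mul]
  have : (Real.pi : ℂ) ≠ 0 := by simp [Real.pi_ne_zero]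
  push_cast
  rw [Finset.mul_sum, Finset.mul_sum, Finset.sum_mul, ← Finset.sum_neg_distrib]
  refine Finset.sum_congr rfl fun i _ => ?_
  field_simp

open FourierTransform in
/-- **Stationary phase identity.** For `σ > 0` and `A` symmetric and invertible, every Schwartz
function `f` satisfies `∫ f(x) e^{iσ⟨x,Ax⟩} dx = (π/σ)^{n/2} |det A|^{−1/2} e^{iπ sgn(A)/4} f(0)
  + (2σ)^{−n/2} |det A|^{−1/2} e^{iπ sgn(A)/4} ∫ (e^{−i⟨ξ,A⁻¹ξ⟩/(4σ)} − 1) 𝓕f(ξ) dξ`. -/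
theorem stmt8 (n : ℕ) (hn : 1 ≤ n) (σ : ℝ) (hσ : 0 < σ)
    (A : Matrix (Fin n) (Fin n) ℝ) (hA : A.IsSymm) (hdet : IsUnit A.det)
    (f : SchwartzMap (EuclideanSpace ℝ (Fin n)) ℂ) :
    (∫ x, (f x) * Complex.exp (Complex.I * σ * quadForm A x))
      = (((Real.pi / σ) ^ ((n : ℝ) / 2) : ℝ) : ℂ) * ((|A.det| ^ (-(1/2) : ℝ) : ℝ) : ℂ)
          * Complex.exp (Complex.I * Real.pi * (matSgn A : ℂ) / 4) * f 0
        + (((2 * σ) ^ (-(n : ℝ) / 2) : ℝ) : ℂ) * ((|A.det| ^ (-(1/2) : ℝ) : ℝ) : ℂ)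
          * Complex.exp (Complex.I * Real.pi * (matSgn A : ℂ) / 4)
          * ∫ ξ, (Complex.exp (-(Complex.I * quadForm A⁻¹ ξ / (4 * σ))) - 1)
              * FT (fun y => f y) ξ := by
  have hpi := Real.pi_pos
  have hH : A.IsHermitian := by
    rw [Matrix.IsHermitian, Matrix.conjTranspose_eq_transpose_of_trivial]; exact hA
  set lam := hH.eigenvalues with hlam
  have hdetp : A.det = ∏ i, lam i := by simpa using hH.det_eq_prod_eigenvalues
  have hl : ∀ i, lam i ≠ 0 := by
    have := hdet.ne_zero
    rw [hdetp, Finset.prod_ne_zero_iff] at this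
    exact fun i => this i (Finset.mem_univ i)
  set b := hH.eigenvectorBasis with hb
  have q1 := quadForm_eigen A lam b hH.mulVec_eigenvectorBasis
  have q2 := quadForm_eigen A⁻¹ (fun i => (lam i)⁻¹) b (by
    intro j
    have h := congrArg (A⁻¹.mulVec) (hH.mulVec_eigenvectorBasis j)
    rw [Matrix.mulVec_mulVec, Matrix.nonsing_inv_mul A hdet, Matrix.one_mulVec,
      Matrix.mulVec_smul] at h
    change A⁻¹.mulVec (hH.eigenvectorBasis j).ofLp = (lam j)⁻¹ • (hH.eigenvectorBasis j).ofLp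
    rw [h, smul_smul, inv_mul_cancel₀ (hl j), one_smul, ← h])
  have hs0 : (σ : ℂ) ≠ 0 := by exact_mod_cast hσ.ne'
  have hp0 : (Real.pi : ℂ) ≠ 0 := by exact_mod_cast hpi.ne'
  have hfF : Integrable (𝓕 (f : EuclideanSpace ℝ (Fin n) → ℂ)) := by
    have := (𝓕 f).integrable (μ := volume)
    rwa [SchwartzMap.fourier_coe] at this
  have mp := b.repr.symm.measurePreserving
  have me := b.repr.symm.toHomeomorph.measurableEmbedding
  have hgF : 𝓕 ((f : EuclideanSpace ℝ (Fin n) → ℂ) ∘ b.repr.symm) =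
      𝓕 (f : EuclideanSpace ℝ (Fin n) → ℂ) ∘ b.repr.symm := by
    ext w
    exact Real.fourier_comp_linearIsometry _ _ _
  have hD := diag_formula (fun i => Real.pi ^ 2 / (σ * lam i))
    (fun i => by have := hl i; positivity) ((f : EuclideanSpace ℝ (Fin n) → ℂ) ∘ b.repr.symm)
    ((mp.integrable_comp_emb me).2 f.integrable)
    (by rw [hgF]; exact (mp.integrable_comp_emb me).2 hfF)
  rw [hgF] at hD
  set J := ∫ x, (f x) * Complex.exp (Complex.I * σ * quadForm A x) with hJ
  set W := ∫ w, 𝓕 (f : EuclideanSpace ℝ (Fin n) → ℂ) w *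
    Complex.exp (-(Complex.I * Real.pi ^ 2 * quadForm A⁻¹ w / σ)) with hW
  have hJ' : ∫ x, ((f : EuclideanSpace ℝ (Fin n) → ℂ) ∘ b.repr.symm) x *
      Complex.exp (-∑ i, Real.pi ^ 2 * (x i : ℂ) ^ 2 /
        (Complex.I * ((Real.pi ^ 2 / (σ * lam i) : ℝ) : ℂ))) = J := by
    rw [hJ]
    refine Eq.trans ?_ (mp.integral_comp me _)
    refine integral_congr_ae (Filter.Eventually.of_forall fun v => ?_)
    change _ * _ = _ * _
    rw [q1]
    congr 2
    push_cast
    rw [Finset.mul_sum, ← Finset.sum_neg_distrib]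
    refine Finset.sum_congr rfl fun i _ => ?_
    have : (lam i : ℂ) ≠ 0 := by exact_mod_cast hl i
    field_simp
    simp
  have hW' : ∫ w, (𝓕 (f : EuclideanSpace ℝ (Fin n) → ℂ) ∘ b.repr.symm) w *
      Complex.exp (-∑ i, (Complex.I * ((Real.pi ^ 2 / (σ * lam i) : ℝ) : ℂ)) * (w i : ℂ) ^ 2)
      = W := by
    rw [hW]
    refine Eq.trans ?_ (mp.integral_comp me _)
    refine integral_congr_ae (Filter.Eventually.of_forall fun v => ?_)
    change _ * _ = _ * _
    rw [q2]
    congr 3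
    push_cast
    rw [Finset.mul_sum, Finset.sum_div]
    refine Finset.sum_congr rfl fun i _ => ?_
    have : (lam i : ℂ) ≠ 0 := by exact_mod_cast hl i
    field_simp
  rw [hJ', hW'] at hD
  have hC : (∏ i, (Real.pi / (Complex.I * ((Real.pi ^ 2 / (σ * lam i) : ℝ) : ℂ))) ^ (1 / 2 : ℂ)) *
      ((((Real.pi / σ) ^ ((n : ℝ) / 2) : ℝ) : ℂ) * ((|A.det| ^ (-(1/2) : ℝ) : ℝ) : ℂ)
          * Complex.exp (Complex.I * Real.pi * (matSgn A : ℂ) / 4)) = 1 := by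
    have h1 : (((Real.pi / σ) ^ ((n : ℝ) / 2) : ℝ) : ℂ) * ((|A.det| ^ (-(1/2) : ℝ) : ℝ) : ℂ)
        = ∏ i, (((Real.pi / |σ * lam i|) ^ (1 / 2 : ℝ) : ℝ) : ℂ) := by
      rw [← Complex.ofReal_mul, ← Complex.ofReal_prod]
      congr 1
      have : ∀ i, (Real.pi / |σ * lam i|) ^ (1 / 2 : ℝ)
          = (Real.pi / σ) ^ (1 / 2 : ℝ) * |lam i| ^ (-(1 / 2) : ℝ) := by
        intro i
        rw [abs_mul, abs_of_pos hσ, Real.rpow_neg (abs_nonneg _), ← Real.inv_rpow (abs_nonneg _),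
          ← Real.mul_rpow (by positivity) (by positivity)]
        congr 1
        field_simp
      simp_rw [this]
      rw [Finset.prod_mul_distrib, Finset.prod_const, Finset.card_univ, Fintype.card_fin,
        Real.finsetProd_rpow _ _ (fun i _ => abs_nonneg _), ← Finset.abs_prod, ← hdetp,
        ← Real.rpow_natCast, ← Real.rpow_mul (by positivity)]
      congr 2
      ring
    have h2 : Complex.exp (Complex.I * Real.pi * (matSgn A : ℂ) / 4) = ∏ i,
        Complex.exp (Complex.I * Real.pi * ((if 0 < σ * lam i then 1 else 0)
          - (if σ * lam i < 0 then 1 else 0)) / 4) := by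
      rw [← Complex.exp_sum]
      congr 1
      rw [← Finset.sum_div, ← Finset.mul_sum, Finset.sum_sub_distrib]
      have e1 : ∀ i, 0 < σ * lam i ↔ 0 < lam i := fun i => mul_pos_iff_of_pos_left hσ
      have e2 : ∀ i, σ * lam i < 0 ↔ lam i < 0 := fun i => by
        constructor
        · intro h; by_contra h'; push Not at h'; nlinarith [mul_nonneg hσ.le h']
        · intro h; exact mul_neg_of_pos_of_neg hσ h
      simp only [e1, e2, matSgn, dif_pos hH, Finset.sum_boole]
      push_cast
      congr!
    rw [h1, h2, ← Finset.prod_mul_distrib, ← Finset.prod_mul_distrib]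
    exact Finset.prod_eq_one fun i _ => sqrt_factor _ (mul_ne_zero hσ.ne' (hl i))
  have hf0 : ∫ w, 𝓕 (f : EuclideanSpace ℝ (Fin n) → ℂ) w = f 0 := by
    have := congrFun (f.continuous.fourierInv_fourier_eq f.integrable hfF) 0
    rw [← this, Real.fourierInv_eq']
    simp
  have hR : ∫ ξ, (Complex.exp (-(Complex.I * quadForm A⁻¹ ξ / (4 * σ))) - 1)
              * FT (fun y => f y) ξ
      = (((2 * Real.pi) ^ ((n : ℝ) / 2) : ℝ) : ℂ) * (W - f 0) := by
    have hsc := Measure.integral_comp_smul_of_nonneg (μ := (volume : Measure (EuclideanSpace ℝ (Fin n))))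
      (fun ξ => (Complex.exp (-(Complex.I * quadForm A⁻¹ ξ / (4 * σ))) - 1)
              * FT (fun y => f y) ξ) (2 * Real.pi) (hR := by positivity)
    rw [finrank_euclideanSpace_fin, eq_inv_smul_iff₀ (by positivity)] at hsc
    rw [← hsc]
    have hpt : ∀ w : EuclideanSpace ℝ (Fin n),
        (Complex.exp (-(Complex.I * quadForm A⁻¹ ((2 * Real.pi) • w) / (4 * σ))) - 1)
              * FT (fun y => f y) ((2 * Real.pi) • w)
        = (((2 * Real.pi) ^ (-(n : ℝ) / 2) : ℝ) : ℂ) *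
          (𝓕 (f : EuclideanSpace ℝ (Fin n) → ℂ) w *
            Complex.exp (-(Complex.I * Real.pi ^ 2 * quadForm A⁻¹ w / σ))
            - 𝓕 (f : EuclideanSpace ℝ (Fin n) → ℂ) w) := by
      intro w
      have hq : quadForm A⁻¹ ((2 * Real.pi) • w) = 4 * Real.pi ^ 2 * quadForm A⁻¹ w := by
        simp only [quadForm, PiLp.smul_apply, smul_eq_mul, Finset.mul_sum]
        refine Finset.sum_congr rfl fun i _ => Finset.sum_congr rfl fun j _ => ?_
        ring
      rw [FT_eq, smul_smul, inv_mul_cancel₀ (by positivity), one_smul, hq]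
      have : (Complex.I * ((4 * Real.pi ^ 2 * quadForm A⁻¹ w : ℝ) : ℂ) / (4 * σ))
          = Complex.I * Real.pi ^ 2 * quadForm A⁻¹ w / σ := by
        push_cast
        field_simp
      rw [this]
      ring
    simp_rw [hpt]
    rw [integral_const_mul, integral_sub _ hfF, hf0, ← hW, Complex.real_smul, ← mul_assoc,
      ← Complex.ofReal_mul]
    · congr 2
      rw [← Real.rpow_natCast, ← Real.rpow_add (by positivity)]
      congr 1
      ring
    · refine hfF.mono (hfF.1.mul (Continuous.aestronglyMeasurable ?_)) ?_
      · unfold quadForm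
        fun_prop
      · filter_upwards with w
        rw [norm_mul, Complex.norm_exp]
        refine mul_le_of_le_one_right (norm_nonneg _) (Real.exp_le_one_iff.2 (le_of_eq ?_))
        have : -(Complex.I * Real.pi ^ 2 * quadForm A⁻¹ w / σ)
          = ((-(Real.pi ^ 2 * quadForm A⁻¹ w / σ) : ℝ) : ℂ) * Complex.I := by
          push_cast; ring
        rw [this, Complex.re_ofReal_mul]
        simp
  have hPQ : (((2 * σ) ^ (-(n : ℝ) / 2) : ℝ) : ℂ) * (((2 * Real.pi) ^ ((n : ℝ) / 2) : ℝ) : ℂ)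
      = (((Real.pi / σ) ^ ((n : ℝ) / 2) : ℝ) : ℂ) := by
    rw [← Complex.ofReal_mul]
    congr 1
    rw [neg_div, Real.rpow_neg (by positivity), ← Real.inv_rpow (by positivity),
      ← Real.mul_rpow (by positivity) (by positivity)]
    congr 1
    field_simp
  rw [hR]
  set K := ∏ i, (Real.pi / (Complex.I * ((Real.pi ^ 2 / (σ * lam i) : ℝ) : ℂ))) ^ (1 / 2 : ℂ)
  generalize (((2 * σ) ^ (-(n : ℝ) / 2) : ℝ) : ℂ) = Q at *
  generalize (((2 * Real.pi) ^ ((n : ℝ) / 2) : ℝ) : ℂ) = R at *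
  generalize (((Real.pi / σ) ^ ((n : ℝ) / 2) : ℝ) : ℂ) = P at *
  generalize ((|A.det| ^ (-(1/2) : ℝ) : ℝ) : ℂ) = D at *
  generalize Complex.exp (Complex.I * Real.pi * (matSgn A : ℂ) / 4) = S at *
  rw [hD]
  linear_combination (-J) * hC - D * S * (K * J - f 0) * hPQ
end

section
/- Let n ≥ 1, let A ∈ ℝ^{n×n} be symmetric and invertible, let s > n/2 and α ∈ (0,1). For a Schwartz function f on ℝⁿ and σ ≥ 1 define Ξ(f) := ∫_{ℝⁿ} f(x) e^{iσ⟨x,Ax⟩} dx − f(0) (π/σ)^{n/2} |det A|^{−1/2} e^{iπ sgn(A)/4}. Then there is a constant C > 0, depending only on n, A, s, α, such that for every σ ≥ 1 and every Schwartz function f, |Ξ(f)| ≤ C σ^{−n/2−α} ( ∫_{ℝⁿ} (1+|ξ|²)^{s+2α} |𝓕f(ξ)|² dξ )^{1/2}. -/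
open MeasureTheory

/-- The stationary-phase remainder
`Ξ(f) = ∫ f(x) e^{iσ⟨x,Ax⟩} dx − f(0) (π/σ)^{n/2} |det A|^{−1/2} e^{iπ sgn(A)/4}`. -/
noncomputable def Xi {n : ℕ} (A : Matrix (Fin n) (Fin n) ℝ) (σ : ℝ)
    (f : SchwartzMap (EuclideanSpace ℝ (Fin n)) ℂ) : ℂ :=
  (∫ x, (f x) * Complex.exp (Complex.I * σ * quadForm A x))
    - f 0 * (((Real.pi / σ) ^ ((n : ℝ) / 2) : ℝ) : ℂ) * ((|A.det| ^ (-(1/2) : ℝ) : ℝ) : ℂ)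
        * Complex.exp (Complex.I * Real.pi * (matSgn A : ℂ) / 4)

open scoped FourierTransform RealInnerProductSpace

lemma gauss_base {n : ℕ} (b : OrthonormalBasis (Fin n) ℝ (EuclideanSpace ℝ (Fin n)))
    {c : Fin n → ℂ} (hc : ∀ i, 0 < (c i).re) :
    Integrable (fun x : EuclideanSpace ℝ (Fin n) =>
      Complex.exp (-∑ i, c i * ((b.repr x i : ℝ) : ℂ) ^ 2)) := by
  have h := GaussianFourier.integrable_cexp_neg_sum_mul_add hc (fun _ => 0)
  simp only [zero_mul, Finset.sum_const_zero, add_zero] at h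
  have h2 := ((PiLp.volume_preserving_ofLp (Fin n)).comp b.measurePreserving_repr)
  have := h2.integrable_comp (g := fun v : Fin n → ℝ =>
      Complex.exp (-∑ i, c i * (v i : ℂ) ^ 2)) h.aestronglyMeasurable
  exact this.2 h

lemma gauss_fourierInv {n : ℕ} (b : OrthonormalBasis (Fin n) ℝ (EuclideanSpace ℝ (Fin n)))
    {c : Fin n → ℂ} (hc : ∀ i, 0 < (c i).re) (w : EuclideanSpace ℝ (Fin n)) :
    𝓕⁻ (fun x : EuclideanSpace ℝ (Fin n) =>
      Complex.exp (-∑ i, c i * ((b.repr x i : ℝ) : ℂ) ^ 2)) w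
    = ∏ i, ((Real.pi / c i : ℂ) ^ (1/2 : ℂ) *
        Complex.exp (-(Real.pi ^ 2 * ((b.repr w i : ℝ) : ℂ) ^ 2 / c i))) := by
  have h := GaussianFourier.integral_cexp_neg_sum_mul_add hc
    (fun i => 2 * Real.pi * Complex.I * ((b.repr w i : ℝ) : ℂ))
  have h2 := ((PiLp.volume_preserving_ofLp (Fin n)).comp b.measurePreserving_repr)
  have he : MeasurableEmbedding (WithLp.ofLp ∘ b.repr : EuclideanSpace ℝ (Fin n) → (Fin n → ℝ)) :=
    (MeasurableEquiv.toLp 2 (Fin n → ℝ)).symm.measurableEmbedding.comp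
      b.repr.toHomeomorph.measurableEmbedding
  rw [← h2.integral_comp he] at h
  rw [Real.fourierInv_eq']
  refine Eq.trans (integral_congr_ae (.of_forall fun x => ?_))
    (h.trans (Finset.prod_congr rfl fun i _ => ?_))
  · simp only
    rw [smul_eq_mul, ← Complex.exp_add, add_comm]
    congr 2
    rw [← b.repr.inner_map_map, PiLp.inner_apply]
    simp only [RCLike.inner_apply, conj_trivial, Function.comp]
    push_cast
    rw [Finset.mul_sum, Finset.sum_mul]
    refine Finset.sum_congr rfl fun i _ => ?_
    ring
  · congr 2
    have : c i ≠ 0 := fun h => by simpa [h] using hc i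
    field_simp
    rw [Complex.I_sq]
    ring

lemma reg_identity {n : ℕ} (b : OrthonormalBasis (Fin n) ℝ (EuclideanSpace ℝ (Fin n)))
    {c : Fin n → ℂ} (hc : ∀ i, 0 < (c i).re) (f : SchwartzMap (EuclideanSpace ℝ (Fin n)) ℂ) :
    ∫ x, f x * Complex.exp (-∑ i, c i * ((b.repr x i : ℝ) : ℂ) ^ 2) =
    ∫ w, (𝓕 f) w * ∏ i, ((Real.pi / c i : ℂ) ^ (1/2 : ℂ) *
        Complex.exp (-(Real.pi ^ 2 * ((b.repr w i : ℝ) : ℂ) ^ 2 / c i))) := by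
  have h := VectorFourier.integral_fourierIntegral_smul_eq_flip (e := Real.fourierChar)
    (L := -innerₗ (EuclideanSpace ℝ (Fin n))) (μ := volume) (ν := volume)
    Real.continuous_fourierChar (by simpa using! continuous_inner.neg)
    (𝓕 f).integrable (gauss_base b hc)
  have e1 : ∀ x, VectorFourier.fourierIntegral Real.fourierChar volume
      (-innerₗ (EuclideanSpace ℝ (Fin n))) (⇑(𝓕 f : SchwartzMap (EuclideanSpace ℝ (Fin n)) ℂ)) x = f x := by
    intro x
    have : 𝓕⁻ (𝓕 f) = f := FourierTransform.fourierInv_fourier_eq f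
    conv_rhs => rw [← this]
    rw [SchwartzMap.fourierInv_coe]
    rfl
  have e2 : (-innerₗ (EuclideanSpace ℝ (Fin n))).flip = -innerₗ (EuclideanSpace ℝ (Fin n)) := by
    ext x y; simp [real_inner_comm]
  rw [e2] at h
  simp only [e1, smul_eq_mul] at h
  rw [h]
  refine integral_congr_ae (.of_forall fun w => ?_)
  simp only
  rw [← gauss_fourierInv b hc w]
  rfl

lemma limit_identity {n : ℕ} (b : OrthonormalBasis (Fin n) ℝ (EuclideanSpace ℝ (Fin n)))
    {μ : Fin n → ℝ} (hμ : ∀ i, μ i ≠ 0) (f : SchwartzMap (EuclideanSpace ℝ (Fin n)) ℂ) :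
    ∫ x, f x * Complex.exp (-∑ i, (-(Complex.I * μ i)) * ((b.repr x i : ℝ) : ℂ) ^ 2) =
    ∫ w, (𝓕 f) w * ∏ i, ((Real.pi / (-(Complex.I * μ i)) : ℂ) ^ (1/2 : ℂ) *
        Complex.exp (-(Real.pi ^ 2 * ((b.repr w i : ℝ) : ℂ) ^ 2 / (-(Complex.I * μ i))))) := by
  let c : ℝ → Fin n → ℂ := fun ε i => (ε : ℂ) - Complex.I * μ i
  have hcre : ∀ ε i, (c ε i).re = ε := by intro ε i; simp [c]
  have hcim : ∀ ε i, (c ε i).im = - μ i := by intro ε i; simp [c]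
  have hc0 : ∀ ε i, c ε i ≠ 0 := by
    intro ε i h
    have := hcim ε i
    rw [h] at this
    exact hμ i (by simpa using this.symm)
  have hcc : ∀ i, Continuous (fun ε : ℝ => c ε i) := by
    intro i; simp only [c]; fun_prop
  have hc00 : ∀ i, c 0 i = -(Complex.I * μ i) := by intro i; simp [c]
  have hsl : ∀ i, (Real.pi / c 0 i : ℂ) ∈ Complex.slitPlane := by
    intro i
    right
    have : (Real.pi / c 0 i : ℂ) = ((Real.pi / μ i : ℝ) : ℂ) * Complex.I := by
      have := hμ i
      have h2 : (μ i : ℂ) ≠ 0 := by exact_mod_cast this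
      rw [hc00]; push_cast
      field_simp
      simp
    rw [this]
    simp [hμ i, Real.pi_ne_zero]
  have hL : Filter.Tendsto (fun ε : ℝ => ∫ x, f x *
      Complex.exp (-∑ i, c ε i * ((b.repr x i : ℝ) : ℂ) ^ 2)) (nhdsWithin 0 (Set.Ioi 0))
      (nhds (∫ x, f x * Complex.exp (-∑ i, c 0 i * ((b.repr x i : ℝ) : ℂ) ^ 2))) := by
    refine tendsto_integral_filter_of_dominated_convergence (fun x => ‖f x‖) ?_ ?_ ?_ ?_
    · refine .of_forall fun ε => Continuous.aestronglyMeasurable ?_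
      have := f.continuous
      fun_prop
    · filter_upwards [self_mem_nhdsWithin] with ε hε
      refine .of_forall fun x => ?_
      rw [norm_mul, Complex.norm_exp]
      refine mul_le_of_le_one_right (norm_nonneg _) ?_
      rw [Real.exp_le_one_iff, Complex.neg_re, neg_nonpos, Complex.re_sum]
      refine Finset.sum_nonneg fun i _ => ?_
      rw [← Complex.ofReal_pow, Complex.re_mul_ofReal, hcre]
      have : (0:ℝ) < ε := hε
      positivity
    · exact f.integrable.norm
    · refine .of_forall fun x => ?_
      refine (Continuous.tendsto ?_ 0).mono_left nhdsWithin_le_nhds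
      fun_prop
  have hR : Filter.Tendsto (fun ε : ℝ => ∫ w, (𝓕 f) w * ∏ i, ((Real.pi / c ε i : ℂ) ^ (1/2 : ℂ) *
        Complex.exp (-(Real.pi ^ 2 * ((b.repr w i : ℝ) : ℂ) ^ 2 / c ε i))))
      (nhdsWithin 0 (Set.Ioi 0))
      (nhds (∫ w, (𝓕 f) w * ∏ i, ((Real.pi / c 0 i : ℂ) ^ (1/2 : ℂ) *
        Complex.exp (-(Real.pi ^ 2 * ((b.repr w i : ℝ) : ℂ) ^ 2 / c 0 i))))) := by
    refine tendsto_integral_filter_of_dominated_convergence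
      (fun w => ‖(𝓕 f) w‖ * ∏ i, (Real.pi / |μ i|) ^ (1/2 : ℝ)) ?_ ?_ ?_ ?_
    · refine .of_forall fun ε => Continuous.aestronglyMeasurable ?_
      have := (𝓕 f).continuous
      fun_prop
    · filter_upwards [self_mem_nhdsWithin] with ε hε
      have hε' : (0:ℝ) < ε := hε
      refine .of_forall fun w => ?_
      rw [norm_mul, norm_prod]
      gcongr with i _
      rw [norm_mul]
      have h1 : ‖(Real.pi / c ε i : ℂ) ^ (1/2 : ℂ)‖ ≤ (Real.pi / |μ i|) ^ (1/2 : ℝ) := by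
        have := Complex.norm_cpow_real (Real.pi / c ε i : ℂ) (1/2)
        push_cast at this
        rw [this, norm_div, Complex.norm_real, Real.norm_of_nonneg Real.pi_pos.le]
        have h3 : |μ i| ≤ ‖c ε i‖ := by
          have := Complex.abs_im_le_norm (c ε i)
          rwa [hcim, abs_neg] at this
        have h4 : 0 < |μ i| := abs_pos.2 (hμ i)
        gcongr
      refine (mul_le_of_le_one_right (norm_nonneg _) ?_).trans h1
      rw [Complex.norm_exp, Real.exp_le_one_iff, Complex.neg_re, neg_nonpos]
      have : (Real.pi ^ 2 * ((b.repr w i : ℝ) : ℂ) ^ 2 / c ε i)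
        = ((Real.pi ^ 2 * (b.repr w i) ^ 2 : ℝ) : ℂ) * (c ε i)⁻¹ := by
        push_cast; rw [div_eq_mul_inv]
      rw [this, Complex.re_ofReal_mul, Complex.inv_re, hcre]
      have := Complex.normSq_nonneg (c ε i)
      positivity
    · exact (𝓕 f).integrable.norm.mul_const _
    · refine .of_forall fun w => ?_
      refine Filter.Tendsto.mono_left ?_ nhdsWithin_le_nhds
      refine Filter.Tendsto.const_mul _ (tendsto_finsetProd _ fun i _ => ?_)
      have hci := (hcc i).continuousAt (x := 0)
      refine Filter.Tendsto.mul ?_ ?_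
      · have : ContinuousAt (fun ε : ℝ => (Real.pi / c ε i : ℂ) ^ (1/2 : ℂ)) 0 :=
          ContinuousAt.cpow (f := fun ε : ℝ => (Real.pi / c ε i : ℂ))
            (continuousAt_const.div hci (hc0 0 i)) continuousAt_const (hsl i)
        exact this
      · have : ContinuousAt (fun ε : ℝ => 
          Complex.exp (-(Real.pi ^ 2 * ((b.repr w i : ℝ) : ℂ) ^ 2 / c ε i))) 0 :=
          (continuousAt_const.div hci (hc0 0 i)).neg.cexp
        exact this
  have heq := tendsto_nhds_unique (hL.congr' ?_) hR
  · simpa only [hc00] using heq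
  · filter_upwards [self_mem_nhdsWithin] with ε hε
    exact reg_identity b (fun i => by rw [hcre]; exact hε) f

lemma sqrt_phase {μ : ℝ} (hμ : μ ≠ 0) :
    (Real.pi / (-(Complex.I * μ)) : ℂ) ^ (1/2 : ℂ) =
      (((Real.pi / |μ|) ^ (1/2 : ℝ) : ℝ) : ℂ) *
        Complex.exp (Complex.I * Real.pi * ((if 0 < μ then 1 else -1 : ℤ) : ℂ) / 4) := by
  have h2 : (μ : ℂ) ≠ 0 := by exact_mod_cast hμ
  have hpos : 0 < Real.pi / |μ| := div_pos Real.pi_pos (abs_pos.2 hμ)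
  rw [Complex.ofReal_cpow hpos.le]
  push_cast
  have key : ∀ δ : ℤ, (δ = 1 ∨ δ = -1) → (Real.pi / (-(Complex.I * μ)) : ℂ) =
      ((Real.pi / |μ| : ℝ) : ℂ) * (δ * Complex.I) →
      (Real.pi / (-(Complex.I * μ)) : ℂ) ^ (1/2 : ℂ) = (Real.pi / (|μ| : ℝ) : ℂ) ^ (1/2 : ℂ) * 
        Complex.exp (Complex.I * Real.pi * (δ : ℂ) / 4) := by
    intro δ hδ h
    have hδ0 : (δ : ℂ) * Complex.I ≠ 0 := by rcases hδ with rfl | rfl <;> simp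
    have hp0 : ((Real.pi / |μ| : ℝ) : ℂ) ≠ 0 := by exact_mod_cast hpos.ne'
    rw [h, ← Complex.ofReal_div, Complex.cpow_def_of_ne_zero (mul_ne_zero hp0 hδ0),
      Complex.log_ofReal_mul hpos hδ0, add_mul, Complex.exp_add,
      Complex.ofReal_log hpos.le, ← Complex.cpow_def_of_ne_zero hp0,
      ← Complex.cpow_def_of_ne_zero hδ0]
    congr 1
    rcases hδ with rfl | rfl
    · rw [Complex.cpow_def_of_ne_zero (by simp)]
      simp only [Int.cast_one, one_mul, Complex.log_I]
      congr 1; ring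
    · rw [Complex.cpow_def_of_ne_zero (by simp)]
      simp only [Int.cast_neg, Int.cast_one, neg_mul, one_mul, Complex.log_neg_I]
      congr 1; ring
  have hfin : ∀ δ : ℤ, (δ = 1 ∨ δ = -1) → |μ| = δ * μ → (Real.pi / (-(Complex.I * μ)) : ℂ) =
      ((Real.pi / |μ| : ℝ) : ℂ) * (δ * Complex.I) := by
    intro δ hδ h
    rw [h]; push_cast
    rcases hδ with rfl | rfl
    all_goals
      push_cast
      field_simp
      simp
  rcases lt_or_gt_of_ne hμ with h | h
  · have := key (-1) (by simp) (hfin _ (by simp) (by rw [abs_of_neg h]; push_cast; ring))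
    simpa [h.not_gt] using this
  · have := key 1 (by simp) (hfin _ (by simp) (by rw [abs_of_pos h]; push_cast; ring))
    simpa [h] using this

lemma quadForm_diag {n : ℕ} {A : Matrix (Fin n) (Fin n) ℝ} (hA : A.IsHermitian)
    (x : EuclideanSpace ℝ (Fin n)) :
    quadForm A x = ∑ i, hA.eigenvalues i * (hA.eigenvectorBasis.repr x i) ^ 2 := by
  set b := hA.eigenvectorBasis
  have h1 : quadForm A x = ⟪x, Matrix.toEuclideanLin A x⟫ := by
    rw [PiLp.inner_apply]
    unfold quadForm
    refine Finset.sum_congr rfl fun i _ => ?_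
    simp [Matrix.toLpLin_apply, Matrix.mulVec, dotProduct, mul_comm]
  have hs := Matrix.isSymmetric_toEuclideanLin_iff.2 hA
  rw [h1, ← b.sum_inner_mul_inner]
  refine Finset.sum_congr rfl fun i _ => ?_
  rw [← hs, OrthonormalBasis.repr_apply_apply]
  have : Matrix.toEuclideanLin A (b i) = hA.eigenvalues i • b i := by
    ext j
    have := congrFun (hA.mulVec_eigenvectorBasis i) j
    simpa [Matrix.toLpLin_apply] using this
  rw [this, real_inner_smul_left, real_inner_comm]
  ring

lemma matSgn_eq {n : ℕ} {A : Matrix (Fin n) (Fin n) ℝ} (hA : A.IsHermitian)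
    (h0 : ∀ i, hA.eigenvalues i ≠ 0) :
    matSgn A = ∑ i, (if 0 < hA.eigenvalues i then 1 else -1 : ℤ) := by
  classical
  unfold matSgn
  rw [dif_pos hA, Finset.card_filter, Finset.card_filter]
  push_cast
  rw [← Finset.sum_sub_distrib]
  refine Finset.sum_congr rfl fun i _ => ?_
  rcases lt_or_gt_of_ne (h0 i) with h | h
  · simp [h, h.not_gt]
  · simp [h, h.not_gt]

lemma prod_const {n : ℕ} {A : Matrix (Fin n) (Fin n) ℝ} (hA : A.IsHermitian)
    (h0 : ∀ i, hA.eigenvalues i ≠ 0) {σ : ℝ} (hσ : 0 < σ) :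
    ∏ i, (Real.pi / (-(Complex.I * (σ * hA.eigenvalues i : ℝ))) : ℂ) ^ (1/2 : ℂ) =
    (((Real.pi / σ) ^ ((n : ℝ) / 2) : ℝ) : ℂ) * ((|A.det| ^ (-(1/2) : ℝ) : ℝ) : ℂ)
        * Complex.exp (Complex.I * Real.pi * (matSgn A : ℂ) / 4) := by
  have h1 : ∀ i, σ * hA.eigenvalues i ≠ 0 := fun i => mul_ne_zero hσ.ne' (h0 i)
  rw [Finset.prod_congr rfl fun i _ => sqrt_phase (h1 i), Finset.prod_mul_distrib,
    ← Complex.exp_sum]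
  congr 1
  · rw [← Complex.ofReal_prod, ← Complex.ofReal_mul]
    congr 1
    rw [Real.finsetProd_rpow _ _ (fun i _ => by positivity)]
    have hd : |A.det| = ∏ i, |hA.eigenvalues i| := by
      rw [hA.det_eq_prod_eigenvalues, ← Finset.abs_prod]; rfl
    have : ∏ i, Real.pi / |σ * hA.eigenvalues i| = (Real.pi / σ) ^ n * |A.det|⁻¹ := by
      rw [hd, ← Finset.prod_inv_distrib]
      have : (Real.pi / σ) ^ n = ∏ i : Fin n, (Real.pi / σ) := by
        rw [Finset.prod_const, Finset.card_univ, Fintype.card_fin]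
      rw [this, ← Finset.prod_mul_distrib]
      refine Finset.prod_congr rfl fun i _ => ?_
      rw [abs_mul, abs_of_pos hσ, div_mul_eq_div_div, div_eq_mul_inv]
    have hp : 0 ≤ Real.pi / σ := div_nonneg Real.pi_pos.le hσ.le
    rw [this, Real.mul_rpow (by positivity) (by positivity), Real.rpow_neg (abs_nonneg _),
      Real.inv_rpow (abs_nonneg _), ← Real.rpow_natCast, ← Real.rpow_mul hp]
    congr 2; ring
  · congr 1
    rw [matSgn_eq hA h0, Int.cast_sum, Finset.mul_sum, Finset.sum_div]
    refine Finset.sum_congr rfl fun i _ => ?_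
    simp [hσ]

lemma Xi_formula {n : ℕ} {A : Matrix (Fin n) (Fin n) ℝ} (hA : A.IsHermitian)
    (h0 : ∀ i, hA.eigenvalues i ≠ 0) {σ : ℝ} (hσ : 0 < σ)
    (f : SchwartzMap (EuclideanSpace ℝ (Fin n)) ℂ) :
    Xi A σ f = (((Real.pi / σ) ^ ((n : ℝ) / 2) : ℝ) : ℂ) * ((|A.det| ^ (-(1/2) : ℝ) : ℝ) : ℂ)
        * Complex.exp (Complex.I * Real.pi * (matSgn A : ℂ) / 4) *
      ∫ w, (𝓕 f) w * (Complex.exp (Complex.I * ((-∑ i, Real.pi ^ 2 *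
        (hA.eigenvectorBasis.repr w i) ^ 2 / (σ * hA.eigenvalues i) : ℝ) : ℂ)) - 1) := by
  have h1 : ∀ i, σ * hA.eigenvalues i ≠ 0 := fun i => mul_ne_zero hσ.ne' (h0 i)
  have hf0 : f 0 = ∫ w, (𝓕 f) w := by
    have : 𝓕⁻ (𝓕 f) = f := FourierTransform.fourierInv_fourier_eq f
    conv_lhs => rw [← this]
    rw [SchwartzMap.fourierInv_coe, Real.fourierInv_eq']
    simp
  have hlim := limit_identity hA.eigenvectorBasis h1 f
  have hq : ∫ x, (f x) * Complex.exp (Complex.I * σ * quadForm A x) =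
      ∫ x, f x * Complex.exp (-∑ i, (-(Complex.I * (σ * hA.eigenvalues i : ℝ))) *
        ((hA.eigenvectorBasis.repr x i : ℝ) : ℂ) ^ 2) := by
    refine integral_congr_ae (.of_forall fun x => ?_)
    simp only
    rw [quadForm_diag hA]
    congr 2
    push_cast
    rw [Finset.mul_sum, ← Finset.sum_neg_distrib]
    refine Finset.sum_congr rfl fun i _ => ?_
    ring
  unfold Xi
  rw [hq, hlim, hf0]
  simp_rw [Finset.prod_mul_distrib, prod_const hA h0 hσ, ← Complex.exp_sum]
  set K := (((Real.pi / σ) ^ ((n : ℝ) / 2) : ℝ) : ℂ) * ((|A.det| ^ (-(1/2) : ℝ) : ℝ) : ℂ)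
        * Complex.exp (Complex.I * Real.pi * (matSgn A : ℂ) / 4) with hK
  have hphase : ∀ w, ∑ i, -((Real.pi : ℂ) ^ 2 * ((hA.eigenvectorBasis.repr w i : ℝ) : ℂ) ^ 2 /
      (-(Complex.I * (σ * hA.eigenvalues i : ℝ)))) = Complex.I * ((-∑ i, Real.pi ^ 2 *
        (hA.eigenvectorBasis.repr w i) ^ 2 / (σ * hA.eigenvalues i) : ℝ) : ℂ) := by
    intro w
    rw [← Finset.sum_neg_distrib]
    push_cast
    rw [Finset.mul_sum]
    refine Finset.sum_congr rfl fun i _ => ?_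
    have h2 : (σ : ℂ) ≠ 0 := by exact_mod_cast hσ.ne'
    have h3 : (hA.eigenvalues i : ℂ) ≠ 0 := by exact_mod_cast h0 i
    field_simp
    rw [Complex.I_sq]
    ring
  simp_rw [hphase]
  have hint : Integrable (fun w => (𝓕 f) w * Complex.exp (Complex.I * ((-∑ i, Real.pi ^ 2 *
        (hA.eigenvectorBasis.repr w i) ^ 2 / (σ * hA.eigenvalues i) : ℝ) : ℂ))) := by
    refine (𝓕 f).integrable.mono (Continuous.aestronglyMeasurable ?_) (.of_forall fun w => ?_)
    · have := (𝓕 f).continuous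
      fun_prop
    · rw [norm_mul, Complex.norm_exp_I_mul_ofReal, mul_one]
  simp_rw [mul_sub, mul_one]
  rw [integral_sub hint (𝓕 f).integrable, mul_sub, ← integral_const_mul]
  congr 1
  · refine integral_congr_ae (.of_forall fun x => ?_)
    simp only
    ring
  · rw [hK]; ring

lemma exp_sub_one_bound {α : ℝ} (hα : α ∈ Set.Ioo (0:ℝ) 1) (t : ℝ) :
    ‖Complex.exp (Complex.I * t) - 1‖ ≤ 2 * |t| ^ α := by
  rcases le_total |t| 1 with h | h
  · have h1 : ‖Complex.exp (Complex.I * t) - 1‖ ≤ |t| := Real.norm_exp_I_mul_ofReal_sub_one_le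
    have h2 : |t| ≤ |t| ^ α := by
      have := Real.rpow_le_rpow_of_exponent_ge' (abs_nonneg t) h hα.1.le hα.2.le
      simpa using this
    have := Real.rpow_nonneg (abs_nonneg t) α
    linarith
  · have h1 : ‖Complex.exp (Complex.I * t) - 1‖ ≤ 2 := by
      refine (norm_sub_le _ _).trans ?_
      rw [Complex.norm_exp_I_mul_ofReal]
      norm_num
    have h2 := Real.one_le_rpow h hα.1.le
    linarith

lemma FT_scale {n : ℕ} (f : SchwartzMap (EuclideanSpace ℝ (Fin n)) ℂ)
    (w : EuclideanSpace ℝ (Fin n)) :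
    FT (fun y => f y) ((2 * Real.pi) • w) = ((2 * Real.pi) ^ (-(n : ℝ) / 2) : ℝ) * (𝓕 f) w := by
  unfold FT
  congr 1
  rw [SchwartzMap.fourier_coe, Real.fourier_eq']
  refine integral_congr_ae (.of_forall fun x => ?_)
  simp only [smul_eq_mul]
  rw [mul_comm]
  congr 2
  simp only [PiLp.inner_apply, RCLike.inner_apply, conj_trivial, PiLp.smul_apply, smul_eq_mul]
  push_cast
  rw [Finset.mul_sum, Finset.mul_sum, Finset.sum_mul, ← Finset.sum_neg_distrib]
  refine Finset.sum_congr rfl fun i _ => ?_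
  ring

lemma FT_weight {n : ℕ} (f : SchwartzMap (EuclideanSpace ℝ (Fin n)) ℂ) (r : ℝ) :
    ∫ ξ : EuclideanSpace ℝ (Fin n), (1 + ‖ξ‖ ^ 2) ^ r * ‖FT (fun y => f y) ξ‖ ^ 2 =
    ∫ w : EuclideanSpace ℝ (Fin n), (1 + ‖(2 * Real.pi) • w‖ ^ 2) ^ r * ‖(𝓕 f) w‖ ^ 2 := by
  have h := Measure.integral_comp_smul_of_nonneg (μ := volume)
    (fun ξ : EuclideanSpace ℝ (Fin n) => (1 + ‖ξ‖ ^ 2) ^ r * ‖FT (fun y => f y) ξ‖ ^ 2)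
    (2 * Real.pi) (hR := by positivity)
  simp only [FT_scale, finrank_euclideanSpace_fin, smul_eq_mul] at h
  have hc : ‖(((2 * Real.pi) ^ (-(n : ℝ) / 2) : ℝ) : ℂ)‖ ^ 2 = ((2 * Real.pi) ^ n)⁻¹ := by
    rw [Complex.norm_real, Real.norm_of_nonneg (by positivity), ← Real.rpow_natCast,
      ← Real.rpow_mul (by positivity), ← Real.rpow_natCast, ← Real.rpow_neg (by positivity)]
    congr 1; push_cast; ring
  have h2 : ∀ w : EuclideanSpace ℝ (Fin n), (1 + ‖(2 * Real.pi) • w‖ ^ 2) ^ r *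
      ‖(((2 * Real.pi) ^ (-(n : ℝ) / 2) : ℝ) : ℂ) * (𝓕 f) w‖ ^ 2 = ((2 * Real.pi) ^ n)⁻¹ *
      ((1 + ‖(2 * Real.pi) • w‖ ^ 2) ^ r * ‖(𝓕 f) w‖ ^ 2) := by
    intro w
    rw [norm_mul, mul_pow, hc]; ring
  simp_rw [h2] at h
  rw [integral_const_mul] at h
  exact (mul_left_cancel₀ (by positivity) h).symm

lemma weight_memLp {n : ℕ} (F : SchwartzMap (EuclideanSpace ℝ (Fin n)) ℂ) {r : ℝ} (hr : 0 ≤ r) :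
    MemLp (fun w : EuclideanSpace ℝ (Fin n) => (1 + ‖(2 * Real.pi) • w‖ ^ 2) ^ r * ‖F w‖) 2 := by
  have hg := Function.hasTemperateGrowth_one_add_norm_sq_rpow (EuclideanSpace ℝ (Fin n)) r
  have h := (SchwartzMap.smulLeftCLM ℂ (fun x : EuclideanSpace ℝ (Fin n) =>
    (1 + ‖x‖ ^ 2) ^ r) F).memLp 2
  have hcont : Continuous (fun w : EuclideanSpace ℝ (Fin n) =>
      (1 + ‖(2 * Real.pi) • w‖ ^ 2) ^ r) :=
    Continuous.rpow_const (by fun_prop) (fun w => Or.inr hr)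
  refine h.of_le_mul (c := ((2 * Real.pi) ^ 2) ^ r)
    (hcont.mul F.continuous.norm).aestronglyMeasurable (.of_forall fun w => ?_)
  rw [SchwartzMap.smulLeftCLM_apply_apply hg, norm_smul (_ ^ r) (F w), norm_mul, norm_norm, ← mul_assoc]
  gcongr
  rw [Real.norm_of_nonneg (by positivity), Real.norm_of_nonneg (by positivity),
    ← Real.mul_rpow (by positivity) (by positivity)]
  gcongr
  rw [norm_smul, Real.norm_of_nonneg (by positivity), mul_pow, mul_add, mul_one]
  gcongr
  nlinarith [Real.pi_gt_three]

lemma base_memLp {n : ℕ} {s : ℝ} (hs : (n : ℝ) / 2 < s) :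
    MemLp (fun w : EuclideanSpace ℝ (Fin n) => (1 + ‖(2 * Real.pi) • w‖ ^ 2) ^ (-s / 2)) 2 := by
  have hcont : Continuous (fun w : EuclideanSpace ℝ (Fin n) =>
      (1 + ‖(2 * Real.pi) • w‖ ^ 2) ^ (-s / 2)) :=
    Continuous.rpow_const (by fun_prop) (fun w => Or.inl (by positivity))
  rw [memLp_two_iff_integrable_sq hcont.aestronglyMeasurable]
  have h := integrable_rpow_neg_one_add_norm_sq (E := EuclideanSpace ℝ (Fin n)) (μ := volume)
    (r := 2 * s) (by rw [finrank_euclideanSpace_fin]; linarith)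
  have h2 := h.comp_smul (R := 2 * Real.pi) (by positivity)
  refine h2.congr (.of_forall fun w => ?_)
  simp only
  rw [← Real.rpow_mul_natCast (by positivity)]
  congr 1; push_cast; ring

lemma cauchy_schwarz_weight {n : ℕ} (F : SchwartzMap (EuclideanSpace ℝ (Fin n)) ℂ) {s α : ℝ}
    (hs : (n : ℝ) / 2 < s) (hα : 0 < α) :
    Integrable (fun w : EuclideanSpace ℝ (Fin n) =>
      (1 + ‖(2 * Real.pi) • w‖ ^ 2) ^ α * ‖F w‖) ∧
    ∫ w : EuclideanSpace ℝ (Fin n), (1 + ‖(2 * Real.pi) • w‖ ^ 2) ^ α * ‖F w‖ ≤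
      (∫ w : EuclideanSpace ℝ (Fin n), ((1 + ‖(2 * Real.pi) • w‖ ^ 2) ^ (-s/2)) ^ (2:ℝ)) ^ ((1:ℝ)/2) *
      (∫ w : EuclideanSpace ℝ (Fin n), (1 + ‖(2 * Real.pi) • w‖ ^ 2) ^ (s + 2 * α) * ‖F w‖ ^ 2)
        ^ ((1:ℝ)/2) := by
  have hs0 : 0 < s := lt_of_le_of_lt (by positivity) hs
  have hu := base_memLp hs
  have hv := weight_memLp F (r := s/2 + α) (by positivity)
  have heq : ∀ w : EuclideanSpace ℝ (Fin n), (1 + ‖(2 * Real.pi) • w‖ ^ 2) ^ (-s/2) *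
      ((1 + ‖(2 * Real.pi) • w‖ ^ 2) ^ (s/2 + α) * ‖F w‖) =
      (1 + ‖(2 * Real.pi) • w‖ ^ 2) ^ α * ‖F w‖ := by
    intro w
    rw [← mul_assoc, ← Real.rpow_add (by positivity)]
    congr 2; ring
  constructor
  · exact (hu.integrable_mul hv).congr (.of_forall heq)
  · have h := integral_mul_le_Lp_mul_Lq_of_nonneg (μ := volume) Real.HolderConjugate.two_two
      (f := fun w : EuclideanSpace ℝ (Fin n) => (1 + ‖(2 * Real.pi) • w‖ ^ 2) ^ (-s/2))
      (g := fun w => (1 + ‖(2 * Real.pi) • w‖ ^ 2) ^ (s/2 + α) * ‖F w‖)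
      (.of_forall fun w => by positivity) (.of_forall fun w => by positivity)
      (by simpa using hu) (by simpa using hv)
    simp only [heq] at h
    refine h.trans (le_of_eq ?_)
    congr 2
    refine integral_congr_ae (.of_forall fun w => ?_)
    simp only
    rw [Real.mul_rpow (by positivity) (by positivity), ← Real.rpow_mul (by positivity)]
    norm_num
    left
    congr 1; ring

/-- **Stationary phase remainder estimate.** Let `A` be symmetric and invertible, `s > n/2`,
`α ∈ (0,1)`. Then there is `C > 0`, depending only on `n, A, s, α`, such that for every `σ ≥ 1`
and every Schwartz function `f`,
`|Ξ(f)| ≤ C σ^{−n/2−α} ( ∫ (1+|ξ|²)^{s+2α} |𝓕f(ξ)|² dξ )^{1/2}`. -/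
theorem stmt9 (n : ℕ) (hn : 1 ≤ n) (A : Matrix (Fin n) (Fin n) ℝ) (hA : A.IsSymm)
    (hdet : IsUnit A.det) (s α : ℝ) (hs : (n : ℝ) / 2 < s) (hα : α ∈ Set.Ioo (0:ℝ) 1) :
    ∃ C > 0, ∀ σ : ℝ, 1 ≤ σ → ∀ f : SchwartzMap (EuclideanSpace ℝ (Fin n)) ℂ,
      ‖Xi A σ f‖ ≤ C * σ ^ (-(n : ℝ) / 2 - α) *
        (∫ ξ : EuclideanSpace ℝ (Fin n),
          (1 + ‖ξ‖ ^ 2) ^ (s + 2 * α) * ‖FT (fun y => f y) ξ‖ ^ 2) ^ ((1:ℝ)/2) := by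
  have hH : A.IsHermitian := by
    rw [Matrix.IsHermitian, Matrix.conjTranspose_eq_transpose_of_trivial]; exact hA
  have h0 : ∀ i, hH.eigenvalues i ≠ 0 := by
    intro i hi
    apply hdet.ne_zero
    rw [hH.det_eq_prod_eigenvalues]
    exact Finset.prod_eq_zero (Finset.mem_univ i) (by simp [hi])
  set D : ℝ := ∑ i, Real.pi ^ 2 / |hH.eigenvalues i| with hD
  have hD0 : 0 ≤ D := Finset.sum_nonneg fun i _ => by positivity
  set J : ℝ := (∫ w : EuclideanSpace ℝ (Fin n),
    ((1 + ‖(2 * Real.pi) • w‖ ^ 2) ^ (-s/2)) ^ (2:ℝ)) ^ ((1:ℝ)/2) with hJ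
  have hJ0 : 0 ≤ J := by positivity
  set X : ℝ := Real.pi ^ ((n:ℝ)/2) * |A.det| ^ (-(1/2) : ℝ) * (2 * D ^ α) * J with hX
  have hX0 : 0 ≤ X := by positivity
  refine ⟨X + 1, by positivity, fun σ hσ f => ?_⟩
  have hσ0 : 0 < σ := by linarith
  rw [FT_weight]
  obtain ⟨hi, hcs⟩ := cauchy_schwarz_weight (𝓕 f) hs hα.1
  rw [← hJ] at hcs
  set R : ℝ := (∫ w : EuclideanSpace ℝ (Fin n),
    (1 + ‖(2 * Real.pi) • w‖ ^ 2) ^ (s + 2 * α) * ‖(𝓕 f) w‖ ^ 2) ^ ((1:ℝ)/2) with hR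
  have hR0 : 0 ≤ R := by positivity
  have hI : ‖∫ w, (𝓕 f) w * (Complex.exp (Complex.I * ((-∑ i, Real.pi ^ 2 *
        (hH.eigenvectorBasis.repr w i) ^ 2 / (σ * hH.eigenvalues i) : ℝ) : ℂ)) - 1)‖ ≤
      (2 * (D / σ) ^ α) * (J * R) := by
    refine (norm_integral_le_of_norm_le (hi.const_mul (2 * (D / σ) ^ α))
      (.of_forall fun w => ?_)).trans ?_
    · rw [norm_mul, mul_comm]
      have hb := exp_sub_one_bound hα (-∑ i, Real.pi ^ 2 *
        (hH.eigenvectorBasis.repr w i) ^ 2 / (σ * hH.eigenvalues i))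
      have ht : |(-∑ i, Real.pi ^ 2 *
        (hH.eigenvectorBasis.repr w i) ^ 2 / (σ * hH.eigenvalues i))| ≤
          D / σ * (1 + ‖(2 * Real.pi) • w‖ ^ 2) := by
        rw [abs_neg]
        refine (Finset.abs_sum_le_sum_abs _ _).trans ?_
        rw [hD, Finset.sum_div, Finset.sum_mul]
        refine Finset.sum_le_sum fun i _ => ?_
        have hy : (hH.eigenvectorBasis.repr w i) ^ 2 ≤ 1 + ‖(2 * Real.pi) • w‖ ^ 2 := by
          have h1 : |hH.eigenvectorBasis.repr w i| ≤ ‖w‖ := by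
            have := PiLp.norm_apply_le (hH.eigenvectorBasis.repr w) i
            rwa [LinearIsometryEquiv.norm_map] at this
          have h2 : (hH.eigenvectorBasis.repr w i) ^ 2 ≤ ‖w‖ ^ 2 := by
            rw [← sq_abs]; gcongr
          have h3 : ‖w‖ ^ 2 ≤ ‖(2 * Real.pi) • w‖ ^ 2 := by
            rw [norm_smul, Real.norm_of_nonneg (by positivity)]
            gcongr
            exact le_mul_of_one_le_left (norm_nonneg _) (by linarith [Real.pi_gt_three])
          linarith
        have hl := abs_pos.2 (h0 i)
        rw [abs_div, abs_mul, abs_mul, abs_of_pos hσ0, abs_of_nonneg (sq_nonneg Real.pi),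
          abs_of_nonneg (sq_nonneg (hH.eigenvectorBasis.repr w i)), div_div, mul_comm σ,
          mul_div_right_comm]
        gcongr
      have ht2 := Real.rpow_le_rpow (abs_nonneg _) ht hα.1.le
      rw [Real.mul_rpow (by positivity) (by positivity)] at ht2
      rw [← mul_assoc, mul_assoc 2]
      gcongr
      exact hb.trans (by gcongr)
    · rw [integral_const_mul]
      gcongr
  rw [Xi_formula hH h0 hσ0, norm_mul, norm_mul, norm_mul, Complex.norm_real, Complex.norm_real,
    Real.norm_of_nonneg (by positivity), Real.norm_of_nonneg (by positivity)]
  have hph : ‖Complex.exp (Complex.I * Real.pi * (matSgn A : ℂ) / 4)‖ = 1 := by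
    have : Complex.I * Real.pi * (matSgn A : ℂ) / 4 =
      Complex.I * ((Real.pi * matSgn A / 4 : ℝ) : ℂ) := by push_cast; ring
    rw [this, Complex.norm_exp_I_mul_ofReal]
  rw [hph, mul_one]
  calc _ ≤ (Real.pi / σ) ^ ((n:ℝ)/2) * |A.det| ^ (-(1/2) : ℝ) * ((2 * (D / σ) ^ α) * (J * R)) := by
        gcongr
    _ = X * σ ^ (-(n : ℝ) / 2 - α) * R := by
        have e : σ ^ (-(n : ℝ) / 2 - α) = (σ ^ ((n:ℝ)/2))⁻¹ * (σ ^ α)⁻¹ := by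
          rw [← Real.rpow_neg hσ0.le, ← Real.rpow_neg hσ0.le, ← Real.rpow_add hσ0]
          congr 1; ring
        rw [e, hX, Real.div_rpow Real.pi_pos.le hσ0.le, Real.div_rpow hD0 hσ0.le]
        ring
    _ ≤ (X + 1) * σ ^ (-(n : ℝ) / 2 - α) * R := by
        gcongr
        linarith
end
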